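/- Fix an integer n ≥ 2, x₀ > 0, σ > 0 and μ > 0, and let s_B(x) = (σ²/(2μ))·(1 - exp(-2μx/σ²)). Let λ(·) = (1 - n·(·) + (n-1)·(·)^{n/(n-1)})/n, and take fees 0 ≤ ĉ < c < 1 with (2μ/σ²)·(1-c)·s_B(x₀)/λ(c) < 1. Let F_c, F_ĉ be the equilibrium cdfs F_c(x) = (c + λ(c)·s_B(x)/s_B(x₀))^{1/(n-1)} on [0, x̄(c)], x̄(c) = -(σ²/(2μ))·log(1 - (2μ/σ²)·(1-c)·s_B(x₀)/λ(c)), F_c = 1 above x̄(c); similarly F_ĉ. Then the expected maximum of n i.i.d. draws is strictly larger under the higher fee: ∫₀^∞ (1 - F_ĉ(x)ⁿ) dx < ∫₀^∞ (1 - F_c(x)ⁿ) dx. Hence the expected performance of the contest winner is strictly increasing in the submission fee when the drift is positive. -/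

import Mathlib

open MeasureTheory

/-- The slope coefficient `λ(c) = (1 - n·c + (n-1)·c^{n/(n-1)})/n` of the equilibrium
winning probability in the `n`-player risk-taking contest with submission fee `c`. -/
noncomputable def lamFee (n : ℕ) (c : ℝ) : ℝ :=
  (1 - n * c + ((n : ℝ) - 1) * c ^ ((n : ℝ) / ((n : ℝ) - 1))) / n

/-- Scale function of Brownian motion with drift `μ` and volatility `σ`:
`s_B(x) = (σ²/(2μ))·(1 - exp(-2μx/σ²))`. -/
noncomputable def sB (μ σ x : ℝ) : ℝ :=
  (σ ^ 2 / (2 * μ)) * (1 - Real.exp (-(2 * μ * x) / σ ^ 2))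

/-- Upper bound of the support of the equilibrium distribution for Brownian motion with
drift: `x̄(c) = -(σ²/(2μ))·log(1 - (2μ/σ²)·(1-c)·s_B(x₀)/λ(c))`. -/
noncomputable def driftXbar (n : ℕ) (x₀ μ σ c : ℝ) : ℝ :=
  -(σ ^ 2 / (2 * μ)) * Real.log (1 - (2 * μ / σ ^ 2) * ((1 - c) * sB μ σ x₀ / lamFee n c))

/-- Equilibrium cdf for Brownian motion with drift:
`F_c(x) = (c + λ(c)·s_B(x)/s_B(x₀))^{1/(n-1)}` on `[0, x̄(c)]`, `1` above, `0` below `0`. -/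
noncomputable def driftF (n : ℕ) (x₀ μ σ c x : ℝ) : ℝ :=
  if x < 0 then 0
  else if x ≤ driftXbar n x₀ μ σ c then
    (c + lamFee n c * sB μ σ x / sB μ σ x₀) ^ ((1 : ℝ) / ((n : ℝ) - 1))
  else 1

theorem one_sub_exp_neg_mul_pos {r x : ℝ} (hr : 0 < r) (hx : 0 < x) :
    0 < 1 - Real.exp (-(r * x)) := by
  have : Real.exp (-(r * x)) < 1 := Real.exp_lt_one_iff.mpr (by nlinarith [mul_pos hr hx])
  linarith

theorem lamFee_eq {n : ℕ} (hn : 2 ≤ n) (c : ℝ) {q : ℝ} (hq : q = 1 / ((n : ℝ) - 1)) :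
    lamFee n c = 1 - c - (1 - c ^ (q + 1)) / (q + 1) := by
  have h2 : (2 : ℝ) ≤ n := by exact_mod_cast hn
  have h1 : (n : ℝ) - 1 ≠ 0 := by linarith
  have h0 : (n : ℝ) ≠ 0 := by linarith
  have he : q + 1 = (n : ℝ) / ((n : ℝ) - 1) := by rw [hq]; field_simp; ring
  rw [lamFee, he]
  field_simp
  ring

theorem lamFee_pos {n : ℕ} (hn : 2 ≤ n) {c : ℝ} (hc0 : 0 ≤ c) (hc1 : c < 1) :
    0 < lamFee n c := by
  have h2 : (2 : ℝ) ≤ n := by exact_mod_cast hn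
  have hq : 0 < 1 / ((n : ℝ) - 1) := by apply one_div_pos.mpr; linarith
  rw [lamFee_eq hn c rfl]
  set q := 1 / ((n : ℝ) - 1)
  have hb := one_add_mul_self_lt_rpow_one_add (s := c - 1) (by linarith) (by linarith)
    (show 1 < q + 1 by linarith)
  rw [add_sub_cancel] at hb
  have : (1 - c ^ (q + 1)) / (q + 1) < 1 - c := by
    rw [div_lt_iff₀ (by linarith)]
    linarith
  linarith

/-- Strict convexity of `λ` together with `λ(1) = 0`. -/
theorem lamFee_mul_lt {n : ℕ} (hn : 2 ≤ n) {c c' : ℝ} (hc' : 0 ≤ c') (hc'c : c' < c)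
    (hc : c < 1) : lamFee n c * (1 - c') < lamFee n c' * (1 - c) := by
  have h2 : (2 : ℝ) ≤ n := by exact_mod_cast hn
  have hq : 0 < 1 / ((n : ℝ) - 1) := by apply one_div_pos.mpr; linarith
  rw [lamFee_eq hn c rfl, lamFee_eq hn c' rfl]
  set q := 1 / ((n : ℝ) - 1)
  have hd : 0 < 1 - c' := by linarith
  have hconv : StrictConvexOn ℝ (Set.Ici 0) fun x : ℝ => x ^ (q + 1) :=
    strictConvexOn_rpow (by linarith)
  have hs := hconv.2 (Set.mem_Ici.mpr hc') (Set.mem_Ici.mpr zero_le_one)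
    (show c' ≠ 1 by linarith)
    (div_pos (show 0 < 1 - c by linarith) hd) (div_pos (show 0 < c - c' by linarith) hd)
    (by field_simp; ring)
  have he : ((1 - c) / (1 - c')) • c' + ((c - c') / (1 - c')) • (1 : ℝ) = c := by
    simp only [smul_eq_mul]; field_simp; ring
  rw [he] at hs
  simp only [smul_eq_mul, Real.one_rpow] at hs
  have hs' : c ^ (q + 1) * (1 - c') < (1 - c) * c' ^ (q + 1) + (c - c') := by
    calc c ^ (q + 1) * (1 - c')
        < ((1 - c) / (1 - c') * c' ^ (q + 1) + (c - c') / (1 - c') * 1) * (1 - c') := by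
          gcongr
      _ = _ := by field_simp
  have hq1 : 0 < q + 1 := by linarith
  have hdiv := div_lt_div_of_pos_right hs' hq1
  have e1 : (1 - c - (1 - c ^ (q + 1)) / (q + 1)) * (1 - c')
      = (1 - c) * (1 - c') - (1 - c') / (q + 1) + c ^ (q + 1) * (1 - c') / (q + 1) := by ring
  have e2 : (1 - c' - (1 - c' ^ (q + 1)) / (q + 1)) * (1 - c)
      = (1 - c) * (1 - c') - (1 - c') / (q + 1)
        + ((1 - c) * c' ^ (q + 1) + (c - c')) / (q + 1) := by ring
  rw [e1, e2]
  linarith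

/-- A power, capped at `1`, of an affine function of the exponential scale `1 - exp(-r x)`. -/
noncomputable def cappedScaleCdf (q r c b x : ℝ) : ℝ :=
  min 1 (c + b * (1 - Real.exp (-(r * x)))) ^ q

section CappedScaleCdf

variable {q r c b x y : ℝ}

theorem affineScale_mono (hr : 0 ≤ r) (hb : 0 ≤ b) (hxy : x ≤ y) :
    c + b * (1 - Real.exp (-(r * x))) ≤ c + b * (1 - Real.exp (-(r * y))) := by
  gcongr

theorem affineScale_nonneg (hr : 0 ≤ r) (hb : 0 ≤ b) (hc : 0 ≤ c) (hx : 0 ≤ x) :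
    0 ≤ c + b * (1 - Real.exp (-(r * x))) := by
  have h := affineScale_mono (c := c) hr hb hx
  simp only [mul_zero, neg_zero, Real.exp_zero, sub_self, add_zero] at h
  exact hc.trans h

theorem continuous_cappedScaleCdf (hq : 0 ≤ q) : Continuous (cappedScaleCdf q r c b) := by
  unfold cappedScaleCdf
  exact Continuous.rpow_const (by fun_prop) fun _ => Or.inr hq

theorem cappedScaleCdf_nonneg (hr : 0 ≤ r) (hb : 0 ≤ b) (hc : 0 ≤ c) (hx : 0 ≤ x) :
    0 ≤ cappedScaleCdf q r c b x :=
  Real.rpow_nonneg (le_min zero_le_one (affineScale_nonneg hr hb hc hx)) q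

theorem cappedScaleCdf_mono (hq : 0 ≤ q) (hr : 0 ≤ r) (hb : 0 ≤ b) (hc : 0 ≤ c) (hx : 0 ≤ x)
    (hxy : x ≤ y) : cappedScaleCdf q r c b x ≤ cappedScaleCdf q r c b y :=
  Real.rpow_le_rpow (le_min zero_le_one (affineScale_nonneg hr hb hc hx))
    (min_le_min_left 1 (affineScale_mono hr hb hxy)) hq

theorem cappedScaleCdf_eq_one (h : 1 ≤ c + b * (1 - Real.exp (-(r * x)))) :
    cappedScaleCdf q r c b x = 1 := by
  rw [cappedScaleCdf, min_eq_left h, Real.one_rpow]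

/-- The affine scale function reaches `1` at a finite point. -/
theorem exists_affineScale_eq_one (hr : 0 < r) (hc : c < 1) (hb : 1 - c < b) :
    ∃ z, 0 < z ∧ c + b * (1 - Real.exp (-(r * z))) = 1 := by
  have hb0 : 0 < b := by linarith
  have hy1 : (1 - c) / b < 1 := (div_lt_one hb0).mpr hb
  have hy0 : 0 < (1 - c) / b := div_pos (by linarith) hb0
  have hlog : Real.log (1 - (1 - c) / b) < 0 := Real.log_neg (by linarith) (by linarith)
  refine ⟨-Real.log (1 - (1 - c) / b) / r, div_pos (by linarith) hr, ?_⟩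
  have : -(r * (-Real.log (1 - (1 - c) / b) / r)) = Real.log (1 - (1 - c) / b) := by
    field_simp
  rw [this, Real.exp_log (by linarith)]
  field_simp
  ring

theorem cappedScaleCdf_eq_one_of_le {z : ℝ} (hr : 0 ≤ r) (hb : 0 ≤ b)
    (hz : c + b * (1 - Real.exp (-(r * z))) = 1) (hzx : z ≤ x) :
    cappedScaleCdf q r c b x = 1 :=
  cappedScaleCdf_eq_one (hz.symm.le.trans (affineScale_mono hr hb hzx))

theorem integrableOn_Ioi_of_eq_zero {f : ℝ → ℝ} (hf : Continuous f) {z : ℝ}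
    (h : ∀ x, z ≤ x → f x = 0) : IntegrableOn f (Set.Ioi 0) := by
  refine IntegrableOn.of_forall_sdiff_eq_zero
    (hf.continuousOn.integrableOn_Icc : IntegrableOn f (Set.Icc 0 z)) measurableSet_Ioi ?_
  rintro x ⟨hx0, hxz⟩
  refine h x (le_of_not_ge fun hx => hxz ⟨le_of_lt hx0, hx⟩)

theorem integrableOn_one_sub_cappedScaleCdf_pow (hq : 0 ≤ q) (hr : 0 < r) (hc : c < 1)
    (hb : 1 - c < b) (n : ℕ) :
    IntegrableOn (fun x => 1 - cappedScaleCdf q r c b x ^ n) (Set.Ioi 0) := by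
  obtain ⟨z, -, hz⟩ := exists_affineScale_eq_one hr hc hb
  refine integrableOn_Ioi_of_eq_zero
    (continuous_const.sub ((continuous_cappedScaleCdf hq).pow n)) (z := z) fun x hx => ?_
  rw [cappedScaleCdf_eq_one_of_le hr.le (by linarith) hz hx, one_pow, sub_self]

theorem integrableOn_one_sub_cappedScaleCdf_mul_exp (hq : 0 ≤ q) (hr : 0 < r) (hc : c < 1)
    (hb : 1 - c < b) :
    IntegrableOn (fun x => (1 - cappedScaleCdf q r c b x) * Real.exp (-(r * x)))
      (Set.Ioi 0) := by
  obtain ⟨z, -, hz⟩ := exists_affineScale_eq_one hr hc hb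
  refine integrableOn_Ioi_of_eq_zero
    ((continuous_const.sub (continuous_cappedScaleCdf hq)).mul (by fun_prop)) (z := z)
    fun x hx => ?_
  rw [cappedScaleCdf_eq_one_of_le hr.le (by linarith) hz hx, sub_self, zero_mul]

/-- The mean of the capped power distribution in the scale `(1 - exp(-r x))/r`. -/
theorem integral_one_sub_cappedScaleCdf_mul_exp (hq : 0 ≤ q) (hr : 0 < r)
    (hc : c < 1) (hb : 1 - c < b) :
    ∫ x in Set.Ioi 0, (1 - cappedScaleCdf q r c b x) * Real.exp (-(r * x)) =
      (1 - c - (1 - c ^ (q + 1)) / (q + 1)) / (b * r) := by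
  obtain ⟨z, hz0, hz⟩ := exists_affineScale_eq_one hr hc hb
  have hb0 : 0 < b := by linarith
  have hq1 : q + 1 ≠ 0 := by linarith
  have hrestrict : ∫ x in Set.Ioi 0, (1 - cappedScaleCdf q r c b x) * Real.exp (-(r * x)) =
      ∫ x in (0 : ℝ)..z, (1 - cappedScaleCdf q r c b x) * Real.exp (-(r * x)) := by
    rw [intervalIntegral.integral_of_le hz0.le]
    refine setIntegral_eq_of_subset_of_forall_sdiff_eq_zero measurableSet_Ioi
      Set.Ioc_subset_Ioi_self ?_
    rintro x ⟨hx0, hxz⟩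
    have hx : z ≤ x := le_of_not_ge fun hx => hxz ⟨hx0, hx⟩
    rw [cappedScaleCdf_eq_one_of_le hr.le hb0.le hz hx, sub_self, zero_mul]
  have hderiv : ∀ x ∈ Set.uIcc 0 z,
      HasDerivAt (fun x => ((c + b * (1 - Real.exp (-(r * x)))) -
          (c + b * (1 - Real.exp (-(r * x)))) ^ (q + 1) / (q + 1)) / (b * r))
        ((1 - cappedScaleCdf q r c b x) * Real.exp (-(r * x))) x := by
    intro x hx
    rw [Set.uIcc_of_le hz0.le] at hx
    have hle : c + b * (1 - Real.exp (-(r * x))) ≤ 1 :=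
      (affineScale_mono hr.le hb0.le hx.2).trans hz.le
    have hexp : HasDerivAt (fun x => Real.exp (-(r * x))) (Real.exp (-(r * x)) * -(r * 1)) x :=
      (((hasDerivAt_id x).const_mul r).neg).exp
    have hu : HasDerivAt (fun x => c + b * (1 - Real.exp (-(r * x))))
        (b * -(Real.exp (-(r * x)) * -(r * 1))) x :=
      ((hexp.const_sub 1).const_mul b).const_add c
    have hp := hu.rpow_const (p := q + 1) (Or.inr (by linarith))
    refine ((hu.sub (hp.div_const (q + 1))).div_const (b * r)).congr_deriv ?_
    rw [cappedScaleCdf, min_eq_right hle, add_sub_cancel_right]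
    field_simp
  rw [hrestrict, intervalIntegral.integral_eq_sub_of_hasDerivAt hderiv
    (Continuous.intervalIntegrable
      ((continuous_const.sub (continuous_cappedScaleCdf hq)).mul (by fun_prop)) _ _), hz]
  simp only [mul_zero, neg_zero, Real.exp_zero, sub_self, add_zero, Real.one_rpow]
  field_simp
  ring

end CappedScaleCdf

/-- If `F` crosses `G` once from above and both have the same mean in the scale with density
`exp(-r x)`, `r > 0`, then the maximum of `n` draws has a larger mean under `F`. -/
theorem integral_one_sub_pow_lt_of_single_crossing {F G : ℝ → ℝ} {r t : ℝ} {n : ℕ} (hn : n ≠ 0)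
    (hr : 0 < r) (ht : 0 < t) (hF0 : ∀ x, 0 < x → 0 ≤ F x) (hG0 : ∀ x, 0 < x → 0 ≤ G x)
    (hF : ∀ x y, 0 < x → x ≤ y → F x ≤ F y) (hG : ∀ x y, 0 < x → x ≤ y → G x ≤ G y)
    (hlt : ∀ x, 0 < x → x < t → G x < F x) (hle : ∀ x, t ≤ x → F x ≤ G x)
    (hFn : IntegrableOn (fun x => 1 - F x ^ n) (Set.Ioi 0))
    (hGn : IntegrableOn (fun x => 1 - G x ^ n) (Set.Ioi 0))
    (hFr : IntegrableOn (fun x => (1 - F x) * Real.exp (-(r * x))) (Set.Ioi 0))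
    (hGr : IntegrableOn (fun x => (1 - G x) * Real.exp (-(r * x))) (Set.Ioi 0))
    (heq : ∫ x in Set.Ioi 0, (1 - F x) * Real.exp (-(r * x)) =
      ∫ x in Set.Ioi 0, (1 - G x) * Real.exp (-(r * x))) :
    ∫ x in Set.Ioi 0, (1 - G x ^ n) < ∫ x in Set.Ioi 0, (1 - F x ^ n) := by
  set S : ℝ → ℝ := fun x => ∑ i ∈ Finset.range n, G x ^ i * F x ^ (n - 1 - i)
  have hSmono : ∀ x y, 0 < x → x ≤ y → S x ≤ S y := by
    intro x y hx hxy
    refine Finset.sum_le_sum fun i _ => ?_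
    have h1 := hF0 x hx
    have h2 := hG0 x hx
    have h3 := hG0 y (hx.trans_le hxy)
    exact mul_le_mul (pow_le_pow_left₀ h2 (hG x y hx hxy) i)
      (pow_le_pow_left₀ h1 (hF x y hx hxy) _) (pow_nonneg h1 _) (pow_nonneg h3 _)
  have hSt : 0 < S t := by
    have hFt : 0 < F t := by
      have h := hlt (t / 2) (by linarith) (by linarith)
      have h' := hG0 (t / 2) (by linarith)
      have h'' := hF (t / 2) t (by linarith) (by linarith)
      linarith
    refine Finset.sum_pos' (fun i _ => mul_nonneg (pow_nonneg (hG0 t ht) _)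
      (pow_nonneg hFt.le _)) ⟨0, Finset.mem_range.mpr (Nat.pos_of_ne_zero hn), ?_⟩
    rw [pow_zero, one_mul]
    exact pow_pos hFt _
  set w := S t * Real.exp (r * t) with hw
  set h : ℝ → ℝ := fun x => ((1 - F x ^ n) - (1 - G x ^ n)) -
    w * ((1 - F x) * Real.exp (-(r * x)) - (1 - G x) * Real.exp (-(r * x))) with hh
  have hfac : ∀ x, h x = (G x - F x) * (S x - S t * Real.exp (r * (t - x))) := by
    intro x
    have h1 : S x * (G x - F x) = G x ^ n - F x ^ n :=
      (Commute.all (G x) (F x)).geom_sum₂_mul n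
    have h2 : Real.exp (r * (t - x)) = Real.exp (r * t) * Real.exp (-(r * x)) := by
      rw [← Real.exp_add]; ring_nf
    simp only [hh, hw, h2]
    linear_combination -h1
  have hpos : ∀ x, 0 < x → x < t → 0 < h x := by
    intro x hx hxt
    rw [hfac]
    refine mul_pos_of_neg_of_neg (by linarith [hlt x hx hxt]) ?_
    have h1 := hSmono x t hx hxt.le
    have h2 : 1 < Real.exp (r * (t - x)) :=
      Real.one_lt_exp_iff.mpr (mul_pos hr (by linarith))
    nlinarith
  have hnonneg : ∀ x, 0 < x → 0 ≤ h x := by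
    intro x hx
    rcases lt_or_ge x t with hxt | hxt
    · exact (hpos x hx hxt).le
    rw [hfac]
    refine mul_nonneg (by linarith [hle x hxt]) ?_
    have h1 := hSmono t x ht hxt
    have h2 : Real.exp (r * (t - x)) ≤ 1 :=
      Real.exp_le_one_iff.mpr (mul_nonpos_of_nonneg_of_nonpos hr.le (by linarith))
    nlinarith
  have hint : IntegrableOn h (Set.Ioi 0) := (hFn.sub hGn).sub ((hFr.sub hGr).const_mul w)
  have hI : 0 < ∫ x in Set.Ioi 0, h x := by
    rw [setIntegral_pos_iff_support_of_nonneg_ae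
      ((ae_restrict_iff' measurableSet_Ioi).mpr (.of_forall hnonneg)) hint]
    refine lt_of_lt_of_le ?_ (measure_mono (s := Set.Ioo 0 t)
      fun x hx => ⟨(hpos x hx.1 hx.2).ne', hx.1⟩)
    rw [Real.volume_Ioo]
    exact ENNReal.ofReal_pos.mpr (by linarith)
  have hval : ∫ x in Set.Ioi 0, h x =
      (∫ x in Set.Ioi 0, (1 - F x ^ n)) - ∫ x in Set.Ioi 0, (1 - G x ^ n) := by
    calc ∫ x in Set.Ioi 0, h x
        = (∫ x in Set.Ioi 0, ((1 - F x ^ n) - (1 - G x ^ n))) - ∫ x in Set.Ioi 0,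
            w * ((1 - F x) * Real.exp (-(r * x)) - (1 - G x) * Real.exp (-(r * x))) :=
          integral_sub (hFn.sub hGn) ((hFr.sub hGr).const_mul w)
      _ = _ := by
          rw [integral_sub hFn hGn, integral_const_mul, integral_sub hFr hGr, heq, sub_self,
            mul_zero, sub_zero]
  linarith

theorem integral_one_sub_cappedScaleCdf_pow_lt {q r c c' b b' : ℝ} {n : ℕ} (hn : n ≠ 0)
    (hq : 0 < q) (hr : 0 < r) (hc' : 0 ≤ c') (hc'c : c' < c) (hc : c < 1) (hb : 1 - c < b)
    (hbb' : b * (1 - c') < b' * (1 - c))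
    (heq : ∫ x in Set.Ioi 0, (1 - cappedScaleCdf q r c b x) * Real.exp (-(r * x)) =
      ∫ x in Set.Ioi 0, (1 - cappedScaleCdf q r c' b' x) * Real.exp (-(r * x))) :
    ∫ x in Set.Ioi 0, (1 - cappedScaleCdf q r c' b' x ^ n) <
      ∫ x in Set.Ioi 0, (1 - cappedScaleCdf q r c b x ^ n) := by
  have hb0 : 0 < b := by linarith
  have hlt : b < b' := by
    by_contra! h
    nlinarith [mul_le_mul_of_nonneg_right h (by linarith : 0 ≤ 1 - c)]
  have hb' : 1 - c' < b' := by nlinarith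
  have hd : 0 < b' - b := by linarith
  have hy : (c - c') / (b' - b) < (1 - c) / b := by
    rw [div_lt_div_iff₀ hd hb0]; nlinarith
  have hyb : (1 - c) / b < 1 := (div_lt_one hb0).mpr hb
  have hy0 : 0 < (c - c') / (b' - b) := div_pos (by linarith) hd
  obtain ⟨y, hydef⟩ : ∃ y, y = (c - c') / (b' - b) := ⟨_, rfl⟩
  rw [← hydef] at hy hy0
  have hyd : y * (b' - b) = c - c' := by rw [hydef]; field_simp
  have hby : c + b * y < 1 := by
    have := (lt_div_iff₀ hb0).mp hy
    linarith
  have hlog : Real.log (1 - y) < 0 := Real.log_neg (by linarith) (by linarith)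
  obtain ⟨t, htdef⟩ : ∃ t, t = -Real.log (1 - y) / r := ⟨_, rfl⟩
  have ht : 0 < t := htdef ▸ div_pos (by linarith) hr
  have hty : Real.exp (-(r * t)) = 1 - y := by
    have : -(r * t) = Real.log (1 - y) := by rw [htdef]; field_simp
    rw [this, Real.exp_log (by linarith)]
  refine integral_one_sub_pow_lt_of_single_crossing hn hr ht
    (fun x hx => cappedScaleCdf_nonneg hr.le hb0.le (by linarith) hx.le)
    (fun x hx => cappedScaleCdf_nonneg hr.le (by linarith) hc' hx.le)
    (fun x y hx hxy => cappedScaleCdf_mono hq.le hr.le hb0.le (by linarith) hx.le hxy)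
    (fun x y hx hxy => cappedScaleCdf_mono hq.le hr.le (by linarith) hc' hx.le hxy)
    ?_ ?_ (integrableOn_one_sub_cappedScaleCdf_pow hq.le hr hc hb n)
    (integrableOn_one_sub_cappedScaleCdf_pow hq.le hr (by linarith) hb' n)
    (integrableOn_one_sub_cappedScaleCdf_mul_exp hq.le hr hc hb)
    (integrableOn_one_sub_cappedScaleCdf_mul_exp hq.le hr (by linarith) hb') heq
  · intro x hx hxt
    have h1 : 1 - Real.exp (-(r * x)) < y := by
      have : Real.exp (-(r * t)) < Real.exp (-(r * x)) := by gcongr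
      linarith
    have h2 : c + b * (1 - Real.exp (-(r * x))) < 1 := by nlinarith
    have h3 : c' + b' * (1 - Real.exp (-(r * x))) < c + b * (1 - Real.exp (-(r * x))) := by
      nlinarith
    rw [cappedScaleCdf, cappedScaleCdf, min_eq_right h2.le, min_eq_right (h3.trans h2).le]
    exact Real.rpow_lt_rpow (affineScale_nonneg hr.le (by linarith) hc' hx.le) h3 hq
  · intro x hxt
    have h1 : y ≤ 1 - Real.exp (-(r * x)) := by
      have : Real.exp (-(r * x)) ≤ Real.exp (-(r * t)) := by gcongr
      linarith
    have h3 : c + b * (1 - Real.exp (-(r * x))) ≤ c' + b' * (1 - Real.exp (-(r * x))) := by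
      nlinarith
    exact Real.rpow_le_rpow (le_min zero_le_one
      (affineScale_nonneg hr.le hb0.le (by linarith) (by linarith)))
      (min_le_min_left 1 h3) hq.le

theorem sB_eq (μ σ x : ℝ) :
    sB μ σ x = (1 - Real.exp (-(2 * μ / σ ^ 2 * x))) / (2 * μ / σ ^ 2) := by
  rw [sB, ← one_div_div (2 * μ) (σ ^ 2)]
  ring_nf

theorem driftF_eq_cappedScaleCdf {n : ℕ} {x₀ μ σ c x a b : ℝ} (hσ : 0 < σ) (hμ : 0 < μ)
    (ha : a = 1 - Real.exp (-(2 * μ / σ ^ 2 * x₀))) (ha0 : 0 < a)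
    (hbdef : b = lamFee n c / a) (hc : c < 1) (hb : 1 - c < b) (hx : 0 ≤ x) :
    driftF n x₀ μ σ c x = cappedScaleCdf (1 / ((n : ℝ) - 1)) (2 * μ / σ ^ 2) c b x := by
  have hr : 0 < 2 * μ / σ ^ 2 := by positivity
  have hb0 : 0 < b := by linarith
  have hlam : lamFee n c = b * a := by rw [hbdef]; field_simp
  have hinv : σ ^ 2 / (2 * μ) = 1 / (2 * μ / σ ^ 2) := (one_div_div _ _).symm
  have hy : (1 - c) / b < 1 := (div_lt_one hb0).mpr hb
  rw [driftF, if_neg hx.not_gt, driftXbar, sB_eq, sB_eq, ← ha, hlam, hinv]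
  set r := 2 * μ / σ ^ 2
  have harg : r * ((1 - c) * (a / r) / (b * a)) = (1 - c) / b := by field_simp
  have hval : b * a * ((1 - Real.exp (-(r * x))) / r) / (a / r) =
      b * (1 - Real.exp (-(r * x))) := by field_simp
  rw [harg, hval, cappedScaleCdf]
  have hiff : x ≤ -(1 / r) * Real.log (1 - (1 - c) / b) ↔
      c + b * (1 - Real.exp (-(r * x))) ≤ 1 := by
    have h1 : -(1 / r) * Real.log (1 - (1 - c) / b) = -Real.log (1 - (1 - c) / b) / r := by ring
    rw [h1, le_div_iff₀ hr, le_neg, mul_comm x r, Real.log_le_iff_le_exp (by linarith),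
      sub_le_comm, le_div_iff₀ hb0]
    constructor <;> intro h <;> linarith
  split_ifs with h
  · rw [min_eq_right (hiff.mp h)]
  · rw [min_eq_left (not_le.mp (mt hiff.mpr h)).le, Real.one_rpow]

/-- When the drift is positive, the expected performance of the contest winner
(the expected maximum of `n` i.i.d. draws from the equilibrium distribution) is
strictly increasing in the submission fee. -/
theorem driftF_expected_max_strictMono (n : ℕ) (hn : 2 ≤ n) (x₀ σ μ : ℝ)
    (hx₀ : 0 < x₀) (hσ : 0 < σ) (hμ : 0 < μ)
    (c c' : ℝ) (hc' : 0 ≤ c') (hc'c : c' < c) (hc : c < 1)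
    (hcond : (2 * μ / σ ^ 2) * ((1 - c) * sB μ σ x₀ / lamFee n c) < 1) :
    (∫ x in Set.Ioi (0 : ℝ), (1 - (driftF n x₀ μ σ c' x) ^ n)) <
      ∫ x in Set.Ioi (0 : ℝ), (1 - (driftF n x₀ μ σ c x) ^ n) := by
  have h2 : (2 : ℝ) ≤ n := by exact_mod_cast hn
  have hq : 0 < 1 / ((n : ℝ) - 1) := by apply one_div_pos.mpr; linarith
  have hr : 0 < 2 * μ / σ ^ 2 := by positivity
  obtain ⟨a, ha⟩ : ∃ a, a = 1 - Real.exp (-(2 * μ / σ ^ 2 * x₀)) := ⟨_, rfl⟩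
  have ha0 : 0 < a := ha ▸ one_sub_exp_neg_mul_pos hr hx₀
  have hl : 0 < lamFee n c := lamFee_pos hn (by linarith) hc
  have hl' : 0 < lamFee n c' := lamFee_pos hn hc' (by linarith)
  have hb : 1 - c < lamFee n c / a := by
    rw [sB_eq, ← ha] at hcond
    have h : 2 * μ / σ ^ 2 * ((1 - c) * (a / (2 * μ / σ ^ 2)) / lamFee n c) =
        (1 - c) * a / lamFee n c := by field_simp
    rw [h, div_lt_one hl] at hcond
    exact (lt_div_iff₀ ha0).mpr hcond
  have hbb' : lamFee n c / a * (1 - c') < lamFee n c' / a * (1 - c) := by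
    rw [div_mul_eq_mul_div, div_mul_eq_mul_div]
    exact div_lt_div_of_pos_right (lamFee_mul_lt hn hc' hc'c hc) ha0
  have hb' : 1 - c' < lamFee n c' / a := by
    have : (1 - c) * (1 - c') < (1 - c) * (lamFee n c' / a) := by nlinarith
    exact lt_of_mul_lt_mul_left this (by linarith)
  have hI : ∀ e, e < 1 → 1 - e < lamFee n e / a → 0 < lamFee n e →
      ∫ x in Set.Ioi 0, (1 - cappedScaleCdf (1 / ((n : ℝ) - 1)) (2 * μ / σ ^ 2) e
        (lamFee n e / a) x) * Real.exp (-(2 * μ / σ ^ 2 * x)) = a / (2 * μ / σ ^ 2) := by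
    intro e he1 heb hle
    rw [integral_one_sub_cappedScaleCdf_mul_exp hq.le hr he1 heb, ← lamFee_eq hn e rfl]
    field_simp
  have hcongr : ∀ e, e < 1 → 1 - e < lamFee n e / a →
      ∫ x in Set.Ioi 0, (1 - driftF n x₀ μ σ e x ^ n) = ∫ x in Set.Ioi 0,
        (1 - cappedScaleCdf (1 / ((n : ℝ) - 1)) (2 * μ / σ ^ 2) e (lamFee n e / a) x ^ n) := by
    intro e he1 heb
    refine setIntegral_congr_fun measurableSet_Ioi fun x hx => ?_
    rw [driftF_eq_cappedScaleCdf hσ hμ ha ha0 rfl he1 heb (le_of_lt hx)]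
  rw [hcongr c' (by linarith) hb', hcongr c hc hb]
  exact integral_one_sub_cappedScaleCdf_pow_lt (by omega) hq hr hc' hc'c hc hb hbb'
    ((hI c hc hb hl).trans (hI c' (by linarith) hb' hl').symm)
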